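/- After t generalized Bellman–Ford iterations, the intermediate pair representation aggregates all walk representations of length at most t: for every natural number t and all vertices u, v : V, H_t u v = ∑_{k=0}^{t} ∑ over all walks p of length k from u to v of ∏_{i=0}^{k-1} A (p i) (p (i+1)), where the inner sum ranges over all maps p : Fin (k+1) → V with p 0 = u and p (Fin.last k) = v, and the empty product is 1. -/

import Mathlib

/-- The generalized Bellman–Ford iterates for a weight matrix `A` over a semiring:
`H 0 = 1` (identity matrix) and `H (t+1) = H t * A + 1`. -/
def bellmanFord {V : Type*} [Fintype V] [DecidableEq V] {S : Type*} [Semiring S]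
    (A : Matrix V V S) : ℕ → Matrix V V S
  | 0 => 1
  | t + 1 => bellmanFord A t * A + 1

theorem pow_entry_eq_sum_walks {V : Type*} [Fintype V] [DecidableEq V]
    {S : Type*} [Semiring S] (A : Matrix V V S) (k : ℕ) (u v : V) :
    (A ^ k) u v = ∑ p : Fin (k + 1) → V, if p 0 = u ∧ p (Fin.last k) = v then
          ((List.finRange k).map fun i => A (p i.castSucc) (p i.succ)).prod else 0 := by
  induction k generalizing v with
  | zero =>
    rw [← (Equiv.funUnique (Fin 1) V).symm.sum_comp]
    by_cases h : u = v
    · subst h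
      simp
    · rw [pow_zero, Matrix.one_apply_ne h, Finset.sum_eq_zero]
      intro x _
      rw [if_neg]
      rintro ⟨h1, h2⟩
      exact h (h1.symm.trans h2)
  | succ k ih =>
    rw [pow_succ, Matrix.mul_apply, ← (Fin.snocEquiv (fun _ : Fin (k + 2) => V)).sum_comp,
      Fintype.sum_prod_type_right]
    simp only [ih, Finset.sum_mul]
    rw [Finset.sum_comm]
    refine Finset.sum_congr rfl fun q _ => ?_
    have key : ∀ x : V, ((List.finRange (k + 1)).map fun i =>
        A ((Fin.snoc q x : Fin (k + 2) → V) i.castSucc)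
          ((Fin.snoc q x : Fin (k + 2) → V) i.succ)).prod =
        ((List.finRange k).map fun i => A (q i.castSucc) (q i.succ)).prod *
          A (q (Fin.last k)) x := by
      intro x
      rw [List.finRange_succ_last]
      simp only [List.map_append, List.map_map, List.prod_append, List.map_cons, List.map_nil,
        List.prod_singleton, Fin.snoc_castSucc, Fin.succ_last, Fin.snoc_last]
      congr 3
      funext i
      simp only [Function.comp, Fin.succ_castSucc, Fin.snoc_castSucc]
    have h0 : ∀ x : V, (Fin.snoc q x : Fin (k + 2) → V) 0 = q 0 := fun x =>
      Fin.snoc_castSucc (α := fun _ => V) x q 0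
    simp only [Fin.snocEquiv, Equiv.coe_fn_mk, key, h0, Fin.snoc_last]
    by_cases hq : q 0 = u
    · simp [hq, ite_mul]
    · simp [hq]

theorem bellmanFord_eq_sum_pow {V : Type*} [Fintype V] [DecidableEq V]
    {S : Type*} [Semiring S] (A : Matrix V V S) (t : ℕ) :
    bellmanFord A t = ∑ k ∈ Finset.range (t + 1), A ^ k := by
  induction t with
  | zero => simp [bellmanFord]
  | succ t ih =>
    rw [bellmanFord, ih, Finset.sum_range_succ' _ (t + 1), Finset.sum_mul, pow_zero]
    simp only [pow_succ]

theorem bellmanFord_entry_eq_sum_over_short_walks {V : Type*} [Fintype V] [DecidableEq V]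
    {S : Type*} [Semiring S] (A : Matrix V V S) (t : ℕ) (u v : V) :
    bellmanFord A t u v =
      ∑ k ∈ Finset.range (t + 1),
        ∑ p : {p : Fin (k + 1) → V // p 0 = u ∧ p (Fin.last k) = v},
          ((List.finRange k).map fun i => A (p.1 i.castSucc) (p.1 i.succ)).prod := by
  rw [bellmanFord_eq_sum_pow, Matrix.sum_apply]
  refine Finset.sum_congr rfl fun k _ => ?_
  rw [pow_entry_eq_sum_walks, ← Finset.sum_filter]
  exact Finset.sum_subtype _ (by simp) _
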